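/- arXiv:2404.14352 — 3 statements merged into one kernel-verified Lean document; each statement's English description precedes it below -/
import Mathlib

section
/- Let U ⊆ ℝ² be an open set, φ : U → ℝ smooth, A(h) = ∂ₓh + φ ∂ᵤh, 𝔖(h) = A(h) − (∂ᵤφ)h, 𝔗(h) = A(h) + (∂ᵤφ)h, and let 𝒦 = −∂ᵤ(A(φ)) = −(∂ᵤ∂ₓφ + φ ∂ᵤ²φ + (∂ᵤφ)²). Then for every smooth function h : U → ℝ one has the operator identity (𝔗 ∘ 𝔖)(h) = A(A(h)) + 𝒦·h on U. -/
/-- Partial derivative with respect to the first variable `x`. -/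
noncomputable def pdx (f : ℝ → ℝ → ℝ) (x u : ℝ) : ℝ := deriv (fun t => f t u) x

/-- Partial derivative with respect to the second variable `u`. -/
noncomputable def pdu (f : ℝ → ℝ → ℝ) (x u : ℝ) : ℝ := deriv (fun t => f x t) u

/-- The vector field `A = ∂ₓ + φ ∂ᵤ` associated with the ODE `u' = φ(x,u)`. -/
noncomputable def Aop (φ h : ℝ → ℝ → ℝ) (x u : ℝ) : ℝ :=
  pdx h x u + φ x u * pdu h x u

/-- The operator `𝔖(h) = A(h) − (∂ᵤφ) h`. -/
noncomputable def Sfrak (φ h : ℝ → ℝ → ℝ) (x u : ℝ) : ℝ :=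
  Aop φ h x u - pdu φ x u * h x u

/-- The operator `𝔗(h) = A(h) + (∂ᵤφ) h`. -/
noncomputable def Tfrak (φ h : ℝ → ℝ → ℝ) (x u : ℝ) : ℝ :=
  Aop φ h x u + pdu φ x u * h x u

/-- The Gaussian curvature `𝒦 = −∂ᵤ(A(φ))` of the associated surface. -/
noncomputable def curvK (φ : ℝ → ℝ → ℝ) (x u : ℝ) : ℝ := -(pdu (Aop φ φ) x u)

theorem hasDerivAt_slice_fst {f : ℝ → ℝ → ℝ} {p : ℝ × ℝ}
    (hf : DifferentiableAt ℝ (fun q : ℝ × ℝ => f q.1 q.2) p) :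
    HasDerivAt (fun t => f t p.2) (fderiv ℝ (fun q : ℝ × ℝ => f q.1 q.2) p (1, 0)) p.1 :=
  HasFDerivAt.comp_hasDerivAt (f := fun t : ℝ => (t, p.2)) p.1 hf.hasFDerivAt
    ((hasDerivAt_id p.1).prodMk (hasDerivAt_const p.1 p.2))

theorem hasDerivAt_slice_snd {f : ℝ → ℝ → ℝ} {p : ℝ × ℝ}
    (hf : DifferentiableAt ℝ (fun q : ℝ × ℝ => f q.1 q.2) p) :
    HasDerivAt (fun t => f p.1 t) (fderiv ℝ (fun q : ℝ × ℝ => f q.1 q.2) p (0, 1)) p.2 :=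
  HasFDerivAt.comp_hasDerivAt (f := fun t : ℝ => (p.1, t)) p.2 hf.hasFDerivAt
    ((hasDerivAt_const p.2 p.1).prodMk (hasDerivAt_id p.2))

theorem pdx_eq_fderiv {f : ℝ → ℝ → ℝ} {p : ℝ × ℝ}
    (hf : DifferentiableAt ℝ (fun q : ℝ × ℝ => f q.1 q.2) p) :
    pdx f p.1 p.2 = fderiv ℝ (fun q : ℝ × ℝ => f q.1 q.2) p (1, 0) :=
  (hasDerivAt_slice_fst hf).deriv

theorem pdu_eq_fderiv {f : ℝ → ℝ → ℝ} {p : ℝ × ℝ}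
    (hf : DifferentiableAt ℝ (fun q : ℝ × ℝ => f q.1 q.2) p) :
    pdu f p.1 p.2 = fderiv ℝ (fun q : ℝ × ℝ => f q.1 q.2) p (0, 1) :=
  (hasDerivAt_slice_snd hf).deriv

theorem pdx_eventuallyEq_fderiv {f : ℝ → ℝ → ℝ} {p : ℝ × ℝ}
    (hf : ContDiffAt ℝ 2 (fun q : ℝ × ℝ => f q.1 q.2) p) :
    (fun q : ℝ × ℝ => pdx f q.1 q.2) =ᶠ[nhds p]
      fun q => fderiv ℝ (fun r : ℝ × ℝ => f r.1 r.2) q (1, 0) := by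
  filter_upwards [hf.eventually (by simp)] with q hq
  exact pdx_eq_fderiv (hq.differentiableAt (by simp))

theorem pdu_eventuallyEq_fderiv {f : ℝ → ℝ → ℝ} {p : ℝ × ℝ}
    (hf : ContDiffAt ℝ 2 (fun q : ℝ × ℝ => f q.1 q.2) p) :
    (fun q : ℝ × ℝ => pdu f q.1 q.2) =ᶠ[nhds p]
      fun q => fderiv ℝ (fun r : ℝ × ℝ => f r.1 r.2) q (0, 1) := by
  filter_upwards [hf.eventually (by simp)] with q hq
  exact pdu_eq_fderiv (hq.differentiableAt (by simp))

theorem differentiableAt_pdx {f : ℝ → ℝ → ℝ} {p : ℝ × ℝ}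
    (hf : ContDiffAt ℝ 2 (fun q : ℝ × ℝ => f q.1 q.2) p) :
    DifferentiableAt ℝ (fun q : ℝ × ℝ => pdx f q.1 q.2) p := by
  have hd := (hf.fderiv_right (m := 1) (by norm_num)).differentiableAt (by simp)
  exact (hd.clm_apply (differentiableAt_const _)).congr_of_eventuallyEq
    (pdx_eventuallyEq_fderiv hf)

theorem differentiableAt_pdu {f : ℝ → ℝ → ℝ} {p : ℝ × ℝ}
    (hf : ContDiffAt ℝ 2 (fun q : ℝ × ℝ => f q.1 q.2) p) :
    DifferentiableAt ℝ (fun q : ℝ × ℝ => pdu f q.1 q.2) p := by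
  have hd := (hf.fderiv_right (m := 1) (by norm_num)).differentiableAt (by simp)
  exact (hd.clm_apply (differentiableAt_const _)).congr_of_eventuallyEq
    (pdu_eventuallyEq_fderiv hf)

/-- Symmetry of the mixed second partial derivatives. -/
theorem pdx_pdu_comm {f : ℝ → ℝ → ℝ} {p : ℝ × ℝ}
    (hf : ContDiffAt ℝ 2 (fun q : ℝ × ℝ => f q.1 q.2) p) :
    pdx (pdu f) p.1 p.2 = pdu (pdx f) p.1 p.2 := by
  have hd := (hf.fderiv_right (m := 1) (by norm_num)).differentiableAt (by simp)
  rw [pdx_eq_fderiv (differentiableAt_pdu hf), pdu_eq_fderiv (differentiableAt_pdx hf),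
    (pdu_eventuallyEq_fderiv hf).fderiv_eq, (pdx_eventuallyEq_fderiv hf).fderiv_eq,
    fderiv_clm_apply hd (differentiableAt_const _),
    fderiv_clm_apply hd (differentiableAt_const _)]
  simpa using (hf.isSymmSndFDerivAt (by simp)).eq (1, 0) (0, 1)

section Leibniz

variable {f g : ℝ → ℝ → ℝ} {p : ℝ × ℝ}

theorem pdx_sub (hf : DifferentiableAt ℝ (fun q : ℝ × ℝ => f q.1 q.2) p)
    (hg : DifferentiableAt ℝ (fun q : ℝ × ℝ => g q.1 q.2) p) :
    pdx (fun x u => f x u - g x u) p.1 p.2 = pdx f p.1 p.2 - pdx g p.1 p.2 :=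
  deriv_fun_sub (hasDerivAt_slice_fst hf).differentiableAt
    (hasDerivAt_slice_fst hg).differentiableAt

theorem pdu_sub (hf : DifferentiableAt ℝ (fun q : ℝ × ℝ => f q.1 q.2) p)
    (hg : DifferentiableAt ℝ (fun q : ℝ × ℝ => g q.1 q.2) p) :
    pdu (fun x u => f x u - g x u) p.1 p.2 = pdu f p.1 p.2 - pdu g p.1 p.2 :=
  deriv_fun_sub (hasDerivAt_slice_snd hf).differentiableAt
    (hasDerivAt_slice_snd hg).differentiableAt

theorem pdu_add (hf : DifferentiableAt ℝ (fun q : ℝ × ℝ => f q.1 q.2) p)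
    (hg : DifferentiableAt ℝ (fun q : ℝ × ℝ => g q.1 q.2) p) :
    pdu (fun x u => f x u + g x u) p.1 p.2 = pdu f p.1 p.2 + pdu g p.1 p.2 :=
  deriv_fun_add (hasDerivAt_slice_snd hf).differentiableAt
    (hasDerivAt_slice_snd hg).differentiableAt

theorem pdx_mul (hf : DifferentiableAt ℝ (fun q : ℝ × ℝ => f q.1 q.2) p)
    (hg : DifferentiableAt ℝ (fun q : ℝ × ℝ => g q.1 q.2) p) :
    pdx (fun x u => f x u * g x u) p.1 p.2 =
      pdx f p.1 p.2 * g p.1 p.2 + f p.1 p.2 * pdx g p.1 p.2 :=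
  deriv_fun_mul (hasDerivAt_slice_fst hf).differentiableAt
    (hasDerivAt_slice_fst hg).differentiableAt

theorem pdu_mul (hf : DifferentiableAt ℝ (fun q : ℝ × ℝ => f q.1 q.2) p)
    (hg : DifferentiableAt ℝ (fun q : ℝ × ℝ => g q.1 q.2) p) :
    pdu (fun x u => f x u * g x u) p.1 p.2 =
      pdu f p.1 p.2 * g p.1 p.2 + f p.1 p.2 * pdu g p.1 p.2 :=
  deriv_fun_mul (hasDerivAt_slice_snd hf).differentiableAt
    (hasDerivAt_slice_snd hg).differentiableAt

theorem Aop_sub (φ : ℝ → ℝ → ℝ) (hf : DifferentiableAt ℝ (fun q : ℝ × ℝ => f q.1 q.2) p)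
    (hg : DifferentiableAt ℝ (fun q : ℝ × ℝ => g q.1 q.2) p) :
    Aop φ (fun x u => f x u - g x u) p.1 p.2 = Aop φ f p.1 p.2 - Aop φ g p.1 p.2 := by
  simp only [Aop, pdx_sub hf hg, pdu_sub hf hg]
  ring

theorem Aop_mul (φ : ℝ → ℝ → ℝ) (hf : DifferentiableAt ℝ (fun q : ℝ × ℝ => f q.1 q.2) p)
    (hg : DifferentiableAt ℝ (fun q : ℝ × ℝ => g q.1 q.2) p) :
    Aop φ (fun x u => f x u * g x u) p.1 p.2 =
      Aop φ f p.1 p.2 * g p.1 p.2 + f p.1 p.2 * Aop φ g p.1 p.2 := by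
  simp only [Aop, pdx_mul hf hg, pdu_mul hf hg]
  ring

end Leibniz

theorem differentiableAt_Aop {φ f : ℝ → ℝ → ℝ} {p : ℝ × ℝ}
    (hφ : DifferentiableAt ℝ (fun q : ℝ × ℝ => φ q.1 q.2) p)
    (hf : ContDiffAt ℝ 2 (fun q : ℝ × ℝ => f q.1 q.2) p) :
    DifferentiableAt ℝ (fun q : ℝ × ℝ => Aop φ f q.1 q.2) p :=
  (differentiableAt_pdx hf).fun_add (hφ.fun_mul (differentiableAt_pdu hf))

/-- Expanded form of the curvature: `𝒦 = −(A(∂ᵤφ) + (∂ᵤφ)²)`. -/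
theorem curvK_eq {φ : ℝ → ℝ → ℝ} {p : ℝ × ℝ}
    (hφ : ContDiffAt ℝ 2 (fun q : ℝ × ℝ => φ q.1 q.2) p) :
    curvK φ p.1 p.2 = -(Aop φ (pdu φ) p.1 p.2 + pdu φ p.1 p.2 ^ 2) := by
  have hd := hφ.differentiableAt (by simp)
  have hu := differentiableAt_pdu hφ
  have key : pdu (Aop φ φ) p.1 p.2 = pdu (pdx φ) p.1 p.2 +
      (pdu φ p.1 p.2 * pdu φ p.1 p.2 + φ p.1 p.2 * pdu (pdu φ) p.1 p.2) :=
    (pdu_add (g := fun x u => φ x u * pdu φ x u) (differentiableAt_pdx hφ)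
      (hd.fun_mul hu)).trans (congrArg _ (pdu_mul hd hu))
  rw [curvK, key, Aop, pdx_pdu_comm hφ]
  ring

/-- The operator identity `(𝔗 ∘ 𝔖)(h) = A²(h) + 𝒦 h` on `U`. -/
theorem stmt2 (U : Set (ℝ × ℝ)) (hU : IsOpen U) (φ h : ℝ → ℝ → ℝ)
    (hφ : ContDiffOn ℝ (⊤ : ℕ∞) (fun p : ℝ × ℝ => φ p.1 p.2) U)
    (hh : ContDiffOn ℝ (⊤ : ℕ∞) (fun p : ℝ × ℝ => h p.1 p.2) U) :
    ∀ p ∈ U, Tfrak φ (Sfrak φ h) p.1 p.2 =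
      Aop φ (Aop φ h) p.1 p.2 + curvK φ p.1 p.2 * h p.1 p.2 := by
  intro p hp
  have two_le : (2 : WithTop ℕ∞) ≤ ((⊤ : ℕ∞) : WithTop ℕ∞) :=
    WithTop.coe_le_coe.2 (le_top : (2 : ℕ∞) ≤ ⊤)
  have hφ2 := (hφ.contDiffAt (hU.mem_nhds hp)).of_le two_le
  have hh2 := (hh.contDiffAt (hU.mem_nhds hp)).of_le two_le
  have hφd := hφ2.differentiableAt (by simp)
  have hhd := hh2.differentiableAt (by simp)
  have hu := differentiableAt_pdu hφ2
  have key : Aop φ (Sfrak φ h) p.1 p.2 = Aop φ (Aop φ h) p.1 p.2 -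
      (Aop φ (pdu φ) p.1 p.2 * h p.1 p.2 + pdu φ p.1 p.2 * Aop φ h p.1 p.2) :=
    (Aop_sub (g := fun x u => pdu φ x u * h x u) φ (differentiableAt_Aop hφd hh2)
      (hu.fun_mul hhd)).trans (congrArg _ (Aop_mul φ hu hhd))
  rw [Tfrak, key, curvK_eq hφ2, Sfrak]
  ring
end

section
/- Let U = {(x,u) ∈ ℝ² : 2u·eˣ − e^{2x} − u² + 1 > 0} and φ(x,u) = eˣ + √(2u eˣ − e^{2x} − u² + 1), with A(h) = ∂ₓh + φ ∂ᵤh. Then the Gaussian curvature of the associated surface is constant equal to 1: −∂ᵤ(A(φ))(x,u) = 1 for all (x,u) ∈ U. -/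
/-- The derivative of `e^x + √(radicand)` along a curve in terms of those of `x` and `u`. -/
theorem hasDerivAt_exp_add_sqrt {f g : ℝ → ℝ} {f' g' t : ℝ} (hf : HasDerivAt f f' t)
    (hg : HasDerivAt g g' t)
    (h : 0 < 2 * g t * Real.exp (f t) - Real.exp (2 * f t) - g t ^ 2 + 1) :
    HasDerivAt (fun s => Real.exp (f s) +
        Real.sqrt (2 * g s * Real.exp (f s) - Real.exp (2 * f s) - g s ^ 2 + 1))
      (Real.exp (f t) * f' + (g t - Real.exp (f t)) * (Real.exp (f t) * f' - g') /
        Real.sqrt (2 * g t * Real.exp (f t) - Real.exp (2 * f t) - g t ^ 2 + 1)) t := by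
  have hR := ((((hg.const_mul 2).mul hf.exp).sub (hf.const_mul 2).exp).sub (hg.pow 2)).add_const 1
  refine (hf.exp.add (hR.sqrt h.ne')).congr_deriv ?_
  have hs := (Real.sqrt_pos.2 h).ne'
  have he : Real.exp (2 * f t) = Real.exp (f t) ^ 2 := by
    rw [← Real.exp_nat_mul]
    norm_num
  simp only [Pi.sub_apply, Pi.mul_apply, Pi.pow_apply]
  field_simp
  rw [he]
  push_cast
  ring

/-- For the ODE `u' = eˣ + √(2u eˣ − e^{2x} − u² + 1)`, the curvature of the
associated surface is constant equal to `1` on the set where the radicand is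
positive. -/
theorem stmt14 :
    let φ : ℝ → ℝ → ℝ := fun x u =>
      Real.exp x + Real.sqrt (2 * u * Real.exp x - Real.exp (2 * x) - u ^ 2 + 1)
    ∀ p ∈ {q : ℝ × ℝ |
        0 < 2 * q.2 * Real.exp q.1 - Real.exp (2 * q.1) - q.2 ^ 2 + 1},
      curvK φ p.1 p.2 = 1 := by
  intro φ p hp
  have hA : ∀ x u : ℝ, 0 < 2 * u * Real.exp x - Real.exp (2 * x) - u ^ 2 + 1 →
      Aop φ φ x u = 2 * Real.exp x - u := by
    intro x u h
    have hx : pdx φ x u = _ :=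
      (hasDerivAt_exp_add_sqrt (hasDerivAt_id x) (hasDerivAt_const x u) h).deriv
    have hu : pdu φ x u = _ :=
      (hasDerivAt_exp_add_sqrt (hasDerivAt_const u x) (hasDerivAt_id u) h).deriv
    have hs := (Real.sqrt_pos.2 h).ne'
    simp only [Aop, hx, hu, φ, id]
    generalize √(2 * u * Real.exp x - Real.exp (2 * x) - u ^ 2 + 1) = s at hs ⊢
    field_simp
    ring
  have hcont : Continuous fun t : ℝ =>
      2 * t * Real.exp p.1 - Real.exp (2 * p.1) - t ^ 2 + 1 := by fun_prop
  have hev : (fun t => Aop φ φ p.1 t) =ᶠ[nhds p.2] fun t => 2 * Real.exp p.1 - t :=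
    (hcont.continuousAt.eventually (lt_mem_nhds hp)).mono fun t ht => hA p.1 t ht
  have hd : pdu (Aop φ φ) p.1 p.2 = -1 :=
    hev.deriv_eq.trans ((hasDerivAt_id p.2).const_sub (2 * Real.exp p.1)).deriv
  rw [curvK, hd, neg_neg]
end

section
/- Let p, q : ℝ → ℝ be smooth, φ(x,u) = q(x)u + p(x), and A(h) = ∂ₓh + φ ∂ᵤh, with 𝔖(h) = A(h) − (∂ᵤφ)h = A(h) − q(x)h. Let Q, H : ℝ → ℝ satisfy Q'(x) = q(x) and H'(x) = e^{−2Q(x)}. Then the function h(x,u) := H(x)e^{Q(x)} satisfies 𝔖(h)(x,u) = e^{−Q(x)} for all (x,u) ∈ ℝ². In particular, 𝔖(h) is nonvanishing, and also the Gaussian curvature 𝒦 = −∂ᵤ(A(φ)) equals −q'(x) − q(x)². -/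
theorem pdu_affine (q p : ℝ → ℝ) (x u : ℝ) : pdu (fun x u => q x * u + p x) x u = q x := by
  simp [pdu]

theorem pdx_affine {q p : ℝ → ℝ} (hq : Differentiable ℝ q) (hp : Differentiable ℝ p) (x u : ℝ) :
    pdx (fun x u => q x * u + p x) x u = deriv q x * u + deriv p x :=
  (((hq x).hasDerivAt.mul_const u).add (hp x).hasDerivAt).deriv

theorem Sfrak_affine_mul_exp {p q Q H : ℝ → ℝ} (hQ : ∀ x, HasDerivAt Q (q x) x)
    (hH : ∀ x, HasDerivAt H (Real.exp (-2 * Q x)) x) (x u : ℝ) :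
    Sfrak (fun x u => q x * u + p x) (fun x _ => H x * Real.exp (Q x)) x u =
      Real.exp (-Q x) := by
  have hx : pdx (fun x _ => H x * Real.exp (Q x)) x u =
      Real.exp (-2 * Q x) * Real.exp (Q x) + H x * (Real.exp (Q x) * q x) :=
    ((hH x).mul (hQ x).exp).deriv
  have hu : pdu (fun x _ => H x * Real.exp (Q x)) x u = 0 := deriv_const _ _
  have he : Real.exp (-2 * Q x) * Real.exp (Q x) = Real.exp (-Q x) := by
    rw [← Real.exp_add]
    congr 1
    ring
  rw [Sfrak, Aop, hx, hu, pdu_affine, he]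
  ring

theorem curvK_affine {q p : ℝ → ℝ} (hq : Differentiable ℝ q) (hp : Differentiable ℝ p)
    (x u : ℝ) : curvK (fun x u => q x * u + p x) x u = -deriv q x - q x ^ 2 := by
  have hA : Aop (fun x u => q x * u + p x) (fun x u => q x * u + p x) =
      fun x u => (deriv q x + q x ^ 2) * u + (deriv p x + p x * q x) := by
    funext x u
    rw [Aop, pdx_affine hq hp, pdu_affine]
    ring
  rw [curvK, hA, pdu_affine (fun x => deriv q x + q x ^ 2) (fun x => deriv p x + p x * q x)]
  ring

/-- For the linear ODE `u' = q(x)u + p(x)`, with `Q' = q` and `H' = e^{−2Q}`,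
the function `h(x,u) = H(x)e^{Q(x)}` satisfies `𝔖(h) = e^{−Q(x)}`, which is
nonvanishing, and the curvature is `𝒦 = −q'(x) − q(x)²`. -/
theorem stmt18 (p q Q H : ℝ → ℝ)
    (hp : ContDiff ℝ (⊤ : ℕ∞) p) (hq : ContDiff ℝ (⊤ : ℕ∞) q)
    (hQ : ∀ x, HasDerivAt Q (q x) x)
    (hH : ∀ x, HasDerivAt H (Real.exp (-2 * Q x)) x) :
    let φ : ℝ → ℝ → ℝ := fun x u => q x * u + p x
    let h : ℝ → ℝ → ℝ := fun x _ => H x * Real.exp (Q x)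
    (∀ x u : ℝ, Sfrak φ h x u = Real.exp (-Q x)) ∧
      (∀ x u : ℝ, Sfrak φ h x u ≠ 0) ∧
      (∀ x u : ℝ, curvK φ x u = -deriv q x - q x ^ 2) := by
  intro φ h
  refine ⟨Sfrak_affine_mul_exp hQ hH, fun x u => ?_,
    curvK_affine (hq.differentiable (by simp)) (hp.differentiable (by simp))⟩
  rw [Sfrak_affine_mul_exp hQ hH]
  exact Real.exp_ne_zero _
end
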